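/- For every nonzero element U of H_0 = ℂ[C] ⊆ H(q) there exist a nonzero scalar a ∈ ℂ, a positive integer N, and a finite composition φ of maps from Φ_ℤ such that φ(U) = a·C^N. -/

import Mathlib

noncomputable section

/-- Generators of the `q`-deformed Heisenberg algebra. -/
inductive HGen : Type
  | A : HGen
  | B : HGen

/-- The defining relation `AB = q • BA + 1` of the `q`-deformed Heisenberg algebra. -/
inductive HRel (q : ℂ) : FreeAlgebra ℂ HGen → FreeAlgebra ℂ HGen → Prop
  | rel : HRel q (FreeAlgebra.ι ℂ HGen.A * FreeAlgebra.ι ℂ HGen.B)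
      (q • (FreeAlgebra.ι ℂ HGen.B * FreeAlgebra.ι ℂ HGen.A) + 1)

/-- The `q`-deformed Heisenberg algebra `H(q)`, presented by generators `A`, `B`
and the single relation `AB - q • BA = 1`. -/
abbrev HAlg (q : ℂ) := RingQuot (HRel q)

/-- The generator `A` of `H(q)`. -/
def genA (q : ℂ) : HAlg q := RingQuot.mkAlgHom ℂ (HRel q) (FreeAlgebra.ι ℂ HGen.A)

/-- The generator `B` of `H(q)`. -/
def genB (q : ℂ) : HAlg q := RingQuot.mkAlgHom ℂ (HRel q) (FreeAlgebra.ι ℂ HGen.B)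

/-- The element `C = AB - BA` of `H(q)`. -/
def genC (q : ℂ) : HAlg q := genA q * genB q - genB q * genA q

/-- The deformed commutator map `θ_n : γ ↦ Aγ - q^n γA` on `H(q)`, `n ∈ ℤ`. -/
def thetaZ (q : ℂ) (n : ℤ) (x : HAlg q) : HAlg q :=
  genA q * x - q ^ n • (x * genA q)

/-- The deformed commutator map `η_n : γ ↦ Bγ - q^n γB` on `H(q)`, `n ∈ ℤ`. -/
def etaZ (q : ℂ) (n : ℤ) (x : HAlg q) : HAlg q :=
  genB q * x - q ^ n • (x * genB q)

/-- The graded component `H_i` of `H(q)`: for `i < 0` the span of `{C^k A^(-i) : k ∈ ℕ}`,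
for `i > 0` the span of `{C^k B^i : k ∈ ℕ}`, and for `i = 0` the span of `{C^k : k ∈ ℕ}`. -/
def Hgr (q : ℂ) (i : ℤ) : Submodule ℂ (HAlg q) :=
  Submodule.span ℂ {x | ∃ k : ℕ,
    x = genC q ^ k * (if i < 0 then genA q ^ (-i).toNat else genB q ^ i.toNat)}

/-- The collection `Φ_ℤ = {θ_n : n ∈ ℤ} ∪ {η_n : n ∈ ℤ}` of deformed commutator maps. -/
def PhiZ (q : ℂ) : Set (HAlg q → HAlg q) :=
  {f | ∃ n : ℤ, f = thetaZ q n ∨ f = etaZ q n}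

theorem genA_mul_genB (q : ℂ) : genA q * genB q = q • (genB q * genA q) + 1 := by
  have h := RingQuot.mkAlgHom_rel ℂ (HRel.rel (q := q))
  simpa [genA, genB] using h

theorem genC_eq (q : ℂ) : genC q = (q - 1) • (genB q * genA q) + 1 := by
  rw [genC, genA_mul_genB]
  module

theorem genB_mul_genA {q : ℂ} (hq : q ≠ 1) :
    genB q * genA q = (q - 1)⁻¹ • (genC q - 1) := by
  rw [genC_eq, add_sub_cancel_right, smul_smul, inv_mul_cancel₀ (sub_ne_zero.2 hq), one_smul]

theorem genA_mul_genC (q : ℂ) : genA q * genC q = q • (genC q * genA q) := by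
  have h : genA q * (genB q * genA q) = q • (genB q * genA q * genA q) + genA q := by
    rw [← mul_assoc, genA_mul_genB, add_mul, one_mul, smul_mul_assoc]
  rw [genC_eq, mul_add, mul_smul_comm, h, add_mul, smul_mul_assoc, mul_one, one_mul]
  module

theorem genC_mul_genB (q : ℂ) : genC q * genB q = q • (genB q * genC q) := by
  have h : genB q * genA q * genB q = q • (genB q * (genB q * genA q)) + genB q := by
    rw [mul_assoc, genA_mul_genB, mul_add, mul_one, mul_smul_comm]
  rw [genC_eq, add_mul, smul_mul_assoc, h, mul_add, mul_smul_comm, mul_one, one_mul]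
  module

theorem genA_mul_genC_pow (q : ℂ) (k : ℕ) :
    genA q * genC q ^ k = q ^ k • (genC q ^ k * genA q) := by
  induction k with
  | zero => simp
  | succ k ih =>
    rw [pow_succ, ← mul_assoc, ih, smul_mul_assoc, mul_assoc, genA_mul_genC, mul_smul_comm,
      smul_smul, ← pow_succ, mul_assoc]

theorem genC_pow_mul_genB (q : ℂ) (k : ℕ) :
    genC q ^ k * genB q = q ^ k • (genB q * genC q ^ k) := by
  induction k with
  | zero => simp
  | succ k ih =>
    rw [pow_succ', mul_assoc, ih, mul_smul_comm, ← mul_assoc, genC_mul_genB, smul_mul_assoc,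
      smul_smul, ← pow_succ, mul_assoc]

theorem genB_mul_genC_pow {q : ℂ} (hq0 : q ≠ 0) (k : ℕ) :
    genB q * genC q ^ k = (q ^ k)⁻¹ • (genC q ^ k * genB q) := by
  rw [genC_pow_mul_genB, smul_smul, inv_mul_cancel₀ (pow_ne_zero k hq0), one_smul]

theorem thetaZ_genC_pow (q : ℂ) (n : ℤ) (k : ℕ) :
    thetaZ q n (genC q ^ k) = (q ^ k - q ^ n) • (genC q ^ k * genA q) := by
  rw [thetaZ, genA_mul_genC_pow]
  module

theorem etaZ_genC_pow_mul_genA {q : ℂ} (hq0 : q ≠ 0) (hq : q ≠ 1) (m : ℤ) (k : ℕ) :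
    etaZ q m (genC q ^ k * genA q) =
      ((q - 1)⁻¹ * ((q ^ k)⁻¹ - q ^ (m + 1))) • genC q ^ (k + 1) -
        ((q - 1)⁻¹ * ((q ^ k)⁻¹ - q ^ m)) • genC q ^ k := by
  have h : genC q ^ k * (genB q * genA q) =
      (q - 1)⁻¹ • (genC q ^ (k + 1) - genC q ^ k) := by
    rw [genB_mul_genA hq, mul_smul_comm, mul_sub, mul_one, pow_succ]
  have hq' : q - 1 ≠ 0 := sub_ne_zero.2 hq
  rw [etaZ, ← mul_assoc, genB_mul_genC_pow hq0, smul_mul_assoc, mul_assoc, mul_assoc,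
    genA_mul_genB, mul_add, mul_smul_comm, h, mul_one, zpow_add₀ hq0, zpow_one]
  match_scalars
  · ring
  · field_simp
    ring

/-- The composite `η_m ∘ θ_n` as a linear map. -/
def etaTheta (q : ℂ) (m n : ℤ) : HAlg q →ₗ[ℂ] HAlg q where
  toFun x := etaZ q m (thetaZ q n x)
  map_add' x y := by
    simp only [etaZ, thetaZ, mul_add, add_mul, mul_sub, sub_mul, smul_add, smul_sub]
    abel
  map_smul' c x := by
    simp only [etaZ, thetaZ, mul_sub, sub_mul, mul_smul_comm, smul_mul_assoc, smul_sub,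
      RingHom.id_apply, smul_comm c]

theorem etaTheta_genC_pow {q : ℂ} (hq0 : q ≠ 0) (hq : q ≠ 1) (m n : ℤ) (k : ℕ) :
    etaTheta q m n (genC q ^ k) =
      ((q ^ k - q ^ n) * ((q - 1)⁻¹ * ((q ^ k)⁻¹ - q ^ (m + 1)))) • genC q ^ (k + 1) -
        ((q ^ k - q ^ n) * ((q - 1)⁻¹ * ((q ^ k)⁻¹ - q ^ m))) • genC q ^ k := by
  have hs (c : ℂ) (x : HAlg q) : etaZ q m (c • x) = c • etaZ q m x := by
    simp only [etaZ, mul_smul_comm, smul_mul_assoc, smul_sub, smul_comm c]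
  change etaZ q m (thetaZ q n _) = _
  rw [thetaZ_genC_pow, hs, etaZ_genC_pow_mul_genA hq0 hq, smul_sub, smul_smul, smul_smul]

/-- Some finite composition of maps from `Φ_ℤ` sends `U` to a nonzero multiple of a positive
power of `C`. -/
def ReachesGenCPow (q : ℂ) (U : HAlg q) : Prop :=
  ∃ (a : ℂ) (N : ℕ) (L : List (HAlg q → HAlg q)),
    a ≠ 0 ∧ 1 ≤ N ∧ (∀ f ∈ L, f ∈ PhiZ q) ∧ (L.foldr (· ∘ ·) id) U = a • genC q ^ N

theorem ReachesGenCPow.of_etaTheta {q : ℂ} {m n : ℤ} {U : HAlg q}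
    (h : ReachesGenCPow q (etaTheta q m n U)) : ReachesGenCPow q U := by
  obtain ⟨a, N, L, ha, hN, hL, hU⟩ := h
  refine ⟨a, N, L ++ [etaZ q m, thetaZ q n], ha, hN, ?_, ?_⟩
  · intro f hf
    simp only [List.mem_append, List.mem_cons, List.not_mem_nil, or_false] at hf
    rcases hf with hf | rfl | rfl
    exacts [hL f hf, ⟨m, Or.inr rfl⟩, ⟨n, Or.inl rfl⟩]
  · have hfold (L : List (HAlg q → HAlg q)) (g : HAlg q → HAlg q) :
        L.foldr (· ∘ ·) g = L.foldr (· ∘ ·) id ∘ g := by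
      induction L with
      | nil => rfl
      | cons f L ih => simp only [List.foldr_cons, ih, Function.comp_assoc]
    rw [List.foldr_append, hfold]
    exact hU

theorem reachesGenCPow_smul_genC_pow {q : ℂ} (hq0 : q ≠ 0) (hq : q ≠ 1) {a : ℂ} (ha : a ≠ 0)
    (k : ℕ) : ReachesGenCPow q (a • genC q ^ k) := by
  rcases Nat.eq_zero_or_pos k with rfl | hk
  · refine .of_etaTheta (m := 0) (n := 1)
      ⟨a * (q - 1), 1, [], mul_ne_zero ha (sub_ne_zero.2 hq), le_rfl, by simp, ?_⟩
    have hq' : q - 1 ≠ 0 := sub_ne_zero.2 hq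
    rw [map_smul, etaTheta_genC_pow hq0 hq]
    simp only [List.foldr_nil, id_eq, pow_zero, zpow_one, zpow_zero, inv_one, sub_self, mul_zero,
      zero_smul, sub_zero, zero_add, smul_smul]
    congr 1
    field_simp
    ring
  · exact ⟨a, k, [], ha, hk, by simp, rfl⟩

theorem reachesGenCPow_add {q : ℂ} (hq0 : q ≠ 0) (hq1 : ∀ m : ℕ, 0 < m → q ^ m ≠ 1) (k d : ℕ)
    {a : ℂ} (ha : a ≠ 0) {R : HAlg q}
    (hR : R ∈ Submodule.span ℂ ((genC q ^ ·) '' Set.Ioc k d)) :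
    ReachesGenCPow q (a • genC q ^ k + R) := by
  have hq : q ≠ 1 := by simpa using hq1 1 one_pos
  induction d generalizing a R with
  | zero =>
    obtain rfl : R = 0 := by simpa using hR
    simpa using reachesGenCPow_smul_genC_pow hq0 hq ha k
  | succ d ih =>
    rcases Nat.lt_or_ge d k with hdk | hkd
    · obtain rfl : R = 0 := by simpa [Set.Ioc_eq_empty_of_le (Nat.succ_le_of_lt hdk)] using hR
      simpa using reachesGenCPow_smul_genC_pow hq0 hq ha k
    set W := Submodule.span ℂ ((genC q ^ ·) '' Set.Ioc k d) with hW
    have hmem {j : ℕ} (h1 : k < j) (h2 : j ≤ d) : genC q ^ j ∈ W :=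
      Submodule.subset_span ⟨j, ⟨h1, h2⟩, rfl⟩
    set T := etaTheta q (-(d + 1 : ℕ)) (d + 1 : ℕ) with hT
    have hTpow (j : ℕ) : T (genC q ^ j) =
        ((q ^ j - q ^ (d + 1)) * ((q - 1)⁻¹ * ((q ^ j)⁻¹ - (q ^ d)⁻¹))) • genC q ^ (j + 1) -
        ((q ^ j - q ^ (d + 1)) * ((q - 1)⁻¹ * ((q ^ j)⁻¹ - (q ^ (d + 1))⁻¹))) • genC q ^ j := by
      have he : (-(d + 1 : ℕ) + 1 : ℤ) = -(d : ℕ) := by push_cast; ring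
      rw [hT, etaTheta_genC_pow hq0 hq, he]
      simp only [zpow_neg, zpow_natCast]
    have hraise {j : ℕ} (h1 : k ≤ j) (h2 : j ≤ d) (c : ℂ) :
        (c * ((q - 1)⁻¹ * ((q ^ j)⁻¹ - (q ^ d)⁻¹))) • genC q ^ (j + 1) ∈ W := by
      rcases h2.eq_or_lt with rfl | h2
      · simp
      · exact W.smul_mem _ (hmem (by omega) h2)
    have hTR : T R ∈ W := by
      have hle : (Submodule.span ℂ ((genC q ^ ·) '' Set.Ioc k (d + 1))).map T ≤ W := by
        rw [Submodule.map_span_le]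
        rintro _ ⟨j, ⟨h1, h2⟩, rfl⟩
        change T (genC q ^ j) ∈ W
        rw [hTpow]
        rcases h2.eq_or_lt with rfl | h2
        · simp
        · exact W.sub_mem (hraise h1.le (by omega) _) (W.smul_mem _ (hmem h1 (by omega)))
      exact hle (Submodule.mem_map_of_mem hR)
    have hne : q ^ k ≠ q ^ (d + 1) := by
      intro h
      obtain ⟨e, rfl⟩ := Nat.exists_eq_add_of_le hkd
      refine hq1 (e + 1) e.succ_pos (mul_left_cancel₀ (pow_ne_zero k hq0) ?_)
      rw [← pow_add, mul_one, h, add_assoc]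
    refine .of_etaTheta (m := -(d + 1 : ℕ)) (n := (d + 1 : ℕ)) ?_
    rw [← hT, map_add, map_smul, hTpow, smul_sub, sub_eq_add_neg, add_comm (a • _), add_assoc,
      smul_smul, ← neg_smul]
    refine ih (neg_ne_zero.2 (mul_ne_zero ha (mul_ne_zero (sub_ne_zero.2 hne) (mul_ne_zero
      (inv_ne_zero (sub_ne_zero.2 hq)) (sub_ne_zero.2 fun h => hne (inv_injective h)))))) ?_
    exact W.add_mem (W.smul_mem _ (hraise le_rfl hkd _)) hTR

theorem Hgr_zero_le_range_aeval (q : ℂ) :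
    Hgr q 0 ≤ LinearMap.range (Polynomial.aeval (R := ℂ) (genC q)).toLinearMap := by
  refine Submodule.span_le.2 ?_
  rintro _ ⟨k, rfl⟩
  exact ⟨Polynomial.X ^ k, by simp⟩

/-- For every nonzero `U ∈ H_0 = ℂ[C] ⊆ H(q)` there exist a nonzero
scalar `a ∈ ℂ`, a positive integer `N`, and a finite composition `φ` of maps from `Φ_ℤ`
such that `φ(U) = a • C^N`. -/
theorem statement_7 (q : ℂ) (hq0 : q ≠ 0) (hq1 : ∀ m : ℕ, 0 < m → q ^ m ≠ 1)
    (U : HAlg q) (hU : U ≠ 0) (hmem : U ∈ Hgr q 0) :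
    ∃ (a : ℂ) (N : ℕ) (L : List (HAlg q → HAlg q)),
      a ≠ 0 ∧ 1 ≤ N ∧ (∀ f ∈ L, f ∈ PhiZ q) ∧
      (L.foldr (· ∘ ·) id) U = a • genC q ^ N := by
  obtain ⟨p, rfl⟩ := Hgr_zero_le_range_aeval q hmem
  have hp : p ≠ 0 := by
    rintro rfl
    simp at hU
  rw [AlgHom.toLinearMap_apply, Polynomial.aeval_eq_sum_range, ← Finset.add_sum_erase _ _
    (Finset.mem_range_succ_iff.2 p.natTrailingDegree_le_natDegree)]
  refine reachesGenCPow_add hq0 hq1 _ p.natDegree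
    (Polynomial.trailingCoeff_nonzero_iff_nonzero.2 hp) (Submodule.sum_mem _ fun i hi => ?_)
  rw [Finset.mem_erase, Finset.mem_range_succ_iff] at hi
  rcases hi.1.lt_or_gt with h | h
  · simp [Polynomial.coeff_eq_zero_of_lt_natTrailingDegree h]
  · exact Submodule.smul_mem _ _ (Submodule.subset_span ⟨i, ⟨h, hi.2⟩, rfl⟩)
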